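/- Let n ≥ 1 and p ≥ 4 be integers and let D = ([a₁,b₁] × [a₂,b₂] × … × [a_n,b_n]) ∩ {0,…,p−1}^n be a nonempty rectangular digit set, where the a_j ≤ b_j are integers in {0,…,p−1}. Then dim_{l¹} λ_{p,D} ≥ log(#D)/log p − n·log(2·log p)/log p. (Here log(#D)/log p is the Hausdorff dimension of the associated missing digits set, so rectangular missing digits measures with large base have l¹-dimension almost equal to their Hausdorff dimension.) -/

import Mathlib

open MeasureTheory Metric Filter Set
open scoped ENNReal NNReal Real Topology

noncomputable section

/-- The Fourier transform of a measure on ℝⁿ: `μ̂(ξ) = ∫ e^{-2πi⟨x,ξ⟩} dμ(x)`. -/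
def mft {n : ℕ} (μ : Measure (EuclideanSpace ℝ (Fin n))) (ξ : EuclideanSpace ℝ (Fin n)) : ℂ :=
  ∫ x, Complex.exp ((((-(2 * Real.pi * (inner ℝ x ξ : ℝ))) : ℝ) : ℂ) * Complex.I) ∂μ

/-- A lattice point `ξ ∈ ℤⁿ` viewed as an element of ℝⁿ. -/
def lat {n : ℕ} (ξ : Fin n → ℤ) : EuclideanSpace ℝ (Fin n) := WithLp.toLp 2 fun i => (ξ i : ℝ)

/-- The box `[0,1]ⁿ`. -/
def box01 (n : ℕ) : Set (EuclideanSpace ℝ (Fin n)) := {θ | ∀ i, θ i ∈ Set.Icc (0 : ℝ) 1}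

/-- `g(ξ) = (1/#D) Σ_{d ∈ D} e^{-2πi⟨d,ξ⟩}`. -/
def gD {n : ℕ} (D : Finset (Fin n → ℕ)) (ξ : EuclideanSpace ℝ (Fin n)) : ℂ :=
  (D.card : ℂ)⁻¹ * ∑ d ∈ D,
    Complex.exp ((((-(2 * Real.pi * ∑ i, (d i : ℝ) * ξ i)) : ℝ) : ℂ) * Complex.I)

/-- Sum of `|μ̂(ξ+θ)|` over lattice points `|ξ| ≤ R` (Euclidean norm). -/
def latSum {n : ℕ} (μ : Measure (EuclideanSpace ℝ (Fin n))) (R : ℝ)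
    (θ : EuclideanSpace ℝ (Fin n)) : ℝ :=
  ∑' ξ : Fin n → ℤ, if ‖lat ξ‖ ≤ R then ‖mft μ (lat ξ + θ)‖ else 0

/-- The Fourier `l¹`-dimension of a measure on ℝⁿ. -/
def diml1 {n : ℕ} (μ : Measure (EuclideanSpace ℝ (Fin n))) : ℝ :=
  sSup {s : ℝ | 0 < s ∧ ∃ C : ℝ, 0 < C ∧ ∀ R : ℝ, 1 ≤ R → ∀ θ ∈ box01 n,
    latSum μ R θ ≤ C * R ^ ((n : ℝ) - s)}


/-- The unimodular exponential. -/
def eE (x : ℝ) : ℂ := Complex.exp ((((-(2 * Real.pi * x)) : ℝ) : ℂ) * Complex.I)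

lemma eE_add (x y : ℝ) : eE (x + y) = eE x * eE y := by
  unfold eE; rw [← Complex.exp_add]; congr 1; push_cast; ring

lemma eE_norm (x : ℝ) : ‖eE x‖ = 1 := Complex.norm_exp_ofReal_mul_I _

lemma eE_zero : eE 0 = 1 := by simp [eE]

lemma eE_nat_mul (m : ℕ) (x : ℝ) : eE (m * x) = eE x ^ m := by
  unfold eE; rw [← Complex.exp_nat_mul]; congr 1; push_cast; ring

lemma eE_int (m : ℤ) : eE m = 1 := by
  unfold eE; rw [Complex.exp_eq_one_iff]; exact ⟨-m, by push_cast; ring⟩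

lemma eE_nat (m : ℕ) : eE m = 1 := by
  simpa using eE_int m

lemma eE_eq_one {x : ℝ} (h : eE x = 1) : ∃ m : ℤ, x = m := by
  unfold eE at h; rw [Complex.exp_eq_one_iff] at h
  obtain ⟨m, hm⟩ := h
  refine ⟨-m, ?_⟩
  have h1 : ((-(2 * Real.pi * x) : ℝ) : ℂ) = ((2 * Real.pi * m : ℝ) : ℂ) := by
    apply mul_right_cancel₀ Complex.I_ne_zero
    rw [hm]; push_cast; ring
  have h2 : -(2 * Real.pi * x) = 2 * Real.pi * m := by exact_mod_cast h1
  have := Real.pi_pos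
  push_cast
  have h3 : (2 * Real.pi) * x = (2 * Real.pi) * (-(m : ℝ)) := by linarith
  exact mul_left_cancel₀ (by positivity) h3

lemma eE_conj (x : ℝ) : (starRingEnd ℂ) (eE x) = eE (-x) := by
  unfold eE; rw [← Complex.exp_conj]; congr 1; simp [Complex.conj_ofNat]

lemma eE_sub_one (x : ℝ) : ‖eE x - 1‖ = 2 * |Real.sin (Real.pi * x)| := by
  unfold eE
  rw [mul_comm, Complex.norm_exp_I_mul_ofReal_sub_one, Real.norm_eq_abs, abs_mul]
  rw [show -(2 * Real.pi * x) / 2 = -(Real.pi * x) by ring, Real.sin_neg]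
  simp

lemma eE_sub_one_le (x : ℝ) : ‖eE x - 1‖ ≤ 2 * Real.pi * |x| := by
  unfold eE
  rw [mul_comm]
  refine (Real.norm_exp_I_mul_ofReal_sub_one_le).trans ?_
  rw [Real.norm_eq_abs, abs_neg, abs_mul, abs_of_pos Real.two_pi_pos]

/-- One-dimensional exponential sum. -/
def F1 (a b : ℕ) (x : ℝ) : ℝ := ‖∑ d ∈ Finset.Icc a b, eE (d * x)‖

lemma F1_nonneg (a b : ℕ) (x : ℝ) : 0 ≤ F1 a b x := norm_nonneg _

lemma F1_add_nat (a b : ℕ) (x : ℝ) (m : ℕ) : F1 a b (x + m) = F1 a b x := by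
  unfold F1; congr 1; apply Finset.sum_congr rfl; intro d _
  rw [mul_add, eE_add, ← Nat.cast_mul, eE_nat, mul_one]

lemma F1_le_card (a b : ℕ) (x : ℝ) : F1 a b x ≤ (Finset.Icc a b).card := by
  refine (norm_sum_le _ _).trans ?_
  simp [eE_norm]

lemma F1_le_sin (a b : ℕ) (hab : a ≤ b) (x : ℝ) : F1 a b x * |Real.sin (Real.pi * x)| ≤ 1 := by
  have h : (∑ d ∈ Finset.Icc a b, eE (d * x)) * (eE x - 1) = eE x ^ (b+1) - eE x ^ a := by
    have := geom_sum_Ico_mul (eE x) (show a ≤ b + 1 by omega)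
    rw [← this]
    simp_rw [eE_nat_mul]
    rfl
  have h2 : F1 a b x * ‖eE x - 1‖ ≤ 2 := by
    unfold F1; rw [← norm_mul, h]
    refine (norm_sub_le _ _).trans ?_
    simp [eE_norm]; norm_num
  rw [eE_sub_one] at h2
  linarith

lemma sin_lower (x : ℝ) (h0 : 0 ≤ x) (h1 : x ≤ 1) : 2 * (x * (1 - x)) ≤ Real.sin (Real.pi * x) := by
  have hp := Real.pi_pos
  rcases le_total x (1/2) with h | h
  · have := Real.mul_le_sin (x := Real.pi * x) (by positivity) (by nlinarith)
    have e : 2 / Real.pi * (Real.pi * x) = 2 * x := by field_simp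
    rw [e] at this
    nlinarith
  · have := Real.mul_le_sin (x := Real.pi * (1 - x)) (mul_nonneg hp.le (by linarith)) (by nlinarith)
    have e : 2 / Real.pi * (Real.pi * (1 - x)) = 2 * (1 - x) := by field_simp
    rw [e, show Real.pi * (1 - x) = Real.pi - Real.pi * x by ring, Real.sin_pi_sub] at this
    nlinarith

lemma orth (p : ℕ) (hp : 1 ≤ p) (d e : ℕ) (hd : d < p) (he : e < p) :
    ∑ t ∈ Finset.range p, eE ((d - e : ℝ) * (t / p)) = if d = e then (p : ℂ) else 0 := by
  have hp0 : (p : ℝ) ≠ 0 := by positivity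
  split_ifs with h
  · subst h; simp [eE_zero]
  · set w := eE ((d - e : ℝ) / p) with hw
    have h1 : ∀ t ∈ Finset.range p, eE ((d - e : ℝ) * (t / p)) = w ^ t := by
      intro t _
      rw [hw, ← eE_nat_mul]; congr 1; ring
    rw [Finset.sum_congr rfl h1]
    have hwp : w ^ p = 1 := by
      rw [hw, ← eE_nat_mul, mul_div_cancel₀ _ hp0]
      have := eE_int ((d : ℤ) - e)
      push_cast at this; exact this
    have hw1 : w ≠ 1 := by
      intro hc
      obtain ⟨m, hm⟩ := eE_eq_one hc
      rw [div_eq_iff hp0] at hm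
      have hm' : (d : ℤ) - e = m * p := by exact_mod_cast hm
      have hdm : (p : ℤ) ∣ (d : ℤ) - e := ⟨m, by rw [hm']; ring⟩
      have := Int.eq_zero_of_abs_lt_dvd hdm (by rw [abs_lt]; constructor <;> omega)
      omega
    have := geom_sum_mul w p
    rw [hwp, sub_self] at this
    exact (mul_eq_zero.mp this).resolve_right (sub_ne_zero.mpr hw1)

lemma parseval (p : ℕ) (hp : 1 ≤ p) (a b : ℕ) (hb : b < p) (u : ℝ) :
    ∑ t ∈ Finset.range p, F1 a b (u + t / p) ^ 2 = p * (Finset.Icc a b).card := by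
  have h : ((∑ t ∈ Finset.range p, F1 a b (u + t / p) ^ 2 : ℝ) : ℂ)
      = ((p * (Finset.Icc a b).card : ℝ) : ℂ) := by
    have h1 : ∀ t : ℕ, ((F1 a b (u + t / p) ^ 2 : ℝ) : ℂ) =
        ∑ d ∈ Finset.Icc a b, ∑ e ∈ Finset.Icc a b,
          eE ((d - e : ℝ) * u) * eE ((d - e : ℝ) * (t / p)) := by
      intro t
      unfold F1
      push_cast
      rw [← Complex.mul_conj', map_sum, Finset.sum_mul_sum]
      apply Finset.sum_congr rfl; intro d _
      apply Finset.sum_congr rfl; intro e _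
      rw [eE_conj, ← eE_add, ← eE_add]; congr 1; ring
    rw [Complex.ofReal_sum]
    simp_rw [h1]
    rw [Finset.sum_comm]
    have h2 : ∀ d ∈ Finset.Icc a b, (∑ t ∈ Finset.range p, ∑ e ∈ Finset.Icc a b,
          eE ((d - e : ℝ) * u) * eE ((d - e : ℝ) * (t / p))) = (p : ℂ) := by
      intro d hd
      rw [Finset.sum_comm]
      have hdp := Finset.mem_Icc.mp hd
      have h3 : ∀ e ∈ Finset.Icc a b, (∑ t ∈ Finset.range p,
          eE ((d - e : ℝ) * u) * eE ((d - e : ℝ) * (t / p))) = if d = e then (p : ℂ) else 0 := by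
        intro e he
        have hep := Finset.mem_Icc.mp he
        rw [← Finset.mul_sum, orth p hp d e (by omega) (by omega)]
        split_ifs with hh
        · subst hh; simp [eE_zero]
        · simp
      rw [Finset.sum_congr rfl h3]
      rw [Finset.sum_ite_eq, if_pos hd]
    rw [Finset.sum_congr rfl h2]
    simp [mul_comm]
  exact_mod_cast h

lemma small_log (p : ℕ) (hp : 4 ≤ p) (hp2 : p ≤ 30) : (p : ℝ) ≤ (2 * Real.log p) ^ 2 := by
  have l2 := Real.log_two_gt_d9
  have key : ∀ k : ℕ, 2 ^ k ≤ p → k * 0.6931471803 ≤ Real.log p := by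
    intro k hk
    have h1 : Real.log ((2 : ℝ) ^ k) ≤ Real.log p := by
      apply Real.log_le_log (by positivity); exact_mod_cast hk
    rw [Real.log_pow] at h1
    have : (k : ℝ) * 0.6931471803 ≤ k * Real.log 2 := by gcongr
    linarith
  rcases lt_or_ge p 8 with h | h
  · have := key 2 hp
    have h7 : (p : ℝ) ≤ 7 := by exact_mod_cast (by omega : p ≤ 7)
    push_cast at this; nlinarith
  rcases lt_or_ge p 16 with h' | h'
  · have := key 3 h
    have h7 : (p : ℝ) ≤ 15 := by exact_mod_cast (by omega : p ≤ 15)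
    push_cast at this; nlinarith
  · have := key 4 h'
    have h7 : (p : ℝ) ≤ 30 := by exact_mod_cast (by omega : p ≤ 30)
    push_cast at this; nlinarith

lemma S_small (p : ℕ) (hp : 4 ≤ p) (hp2 : p ≤ 30) (a b : ℕ) (hb : b < p) (u : ℝ) :
    ∑ t ∈ Finset.range p, F1 a b (u + t / p) ≤ p * (2 * Real.log p) := by
  have h1 := sq_sum_le_card_mul_sum_sq (s := Finset.range p) (f := fun t : ℕ => F1 a b (u + t / p))
  rw [parseval p (by omega) a b hb u, Finset.card_range] at h1
  have hc : ((Finset.Icc a b).card : ℝ) ≤ p := by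
    rw [Nat.card_Icc]; exact_mod_cast (by omega : b + 1 - a ≤ p)
  have hlog : 0 ≤ Real.log p := Real.log_natCast_nonneg p
  have h2 := small_log p hp hp2
  have hp0 : (0:ℝ) ≤ p := by positivity
  refine (sq_le_sq₀ (Finset.sum_nonneg fun _ _ => F1_nonneg _ _ _) (by positivity)).mp ?_
  calc _ ≤ (p : ℝ) * (p * (Finset.Icc a b).card) := h1
    _ ≤ p * (p * (2 * Real.log p) ^ 2) := by gcongr; linarith
    _ = _ := by ring

lemma S_large_aux (p : ℕ) (hp : 31 ≤ p) (a b : ℕ) (hab : a ≤ b) (hb : b < p) (u : ℝ)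
    (hu0 : 0 ≤ u) (hu1 : u < 1 / p) :
    ∑ t ∈ Finset.range p, F1 a b (u + t / p) ≤ p * (2 * Real.log p) := by
  obtain ⟨q, rfl⟩ : ∃ q, p = q + 2 := ⟨p - 2, by omega⟩
  set P : ℝ := ((q + 2 : ℕ) : ℝ) with hP
  have hPq : P = q + 2 := by rw [hP]; push_cast; ring
  have hPpos : 0 < P := by rw [hPq]; positivity
  have hc : ((Finset.Icc a b).card : ℝ) ≤ P := by
    rw [Nat.card_Icc, hP]; exact_mod_cast (by omega : b + 1 - a ≤ q + 2)
  rw [Finset.sum_range_succ, Finset.sum_range_succ']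
  have e1 := (F1_le_card a b (u + ((q + 1 : ℕ) : ℝ) / P)).trans hc
  have e2 := (F1_le_card a b (u + ((0 : ℕ) : ℝ) / P)).trans hc
  have hmid : ∀ t ∈ Finset.range q, F1 a b (u + ((t + 1 : ℕ) : ℝ) / P) ≤
      P / 2 * (((t : ℝ) + 1)⁻¹ + ((q - 1 - t : ℕ) + 1 : ℝ)⁻¹) := by
    intro t ht
    have htq := Finset.mem_range.mp ht
    obtain ⟨r, rfl⟩ : ∃ r, q = t + 1 + r := ⟨q - 1 - t, by omega⟩
    rw [show t + 1 + r - 1 - t = r by omega]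
    set x := u + ((t + 1 : ℕ) : ℝ) / P with hx
    have hPx : P * x = P * u + (t + 1) := by rw [hx]; push_cast; field_simp
    have hPu : P * u < 1 := by rw [lt_div_iff₀ hPpos] at hu1; linarith
    have hPu0 : 0 ≤ P * u := by positivity
    have hPe : P = t + r + 3 := by rw [hPq]; push_cast; ring
    have hx0 : ((t : ℝ) + 1) / P ≤ x := by rw [div_le_iff₀ hPpos]; linarith
    have hx1 : ((r : ℝ) + 1) / P ≤ 1 - x := by rw [div_le_iff₀ hPpos]; nlinarith
    have hxp : 0 < x := lt_of_lt_of_le (by positivity) hx0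
    have hxp1 : 0 < 1 - x := lt_of_lt_of_le (by positivity) hx1
    have hs := sin_lower x hxp.le (by linarith)
    have hF := F1_le_sin a b hab x
    have hF2 : F1 a b x * (2 * (x * (1 - x))) ≤ 1 :=
      le_trans (mul_le_mul_of_nonneg_left (hs.trans (le_abs_self _)) (F1_nonneg _ _ _)) hF
    have hF3 : F1 a b x ≤ 1 / (2 * (x * (1 - x))) := by
      rw [le_div_iff₀ (by positivity)]; exact hF2
    refine hF3.trans ?_
    have : 1 / (2 * (x * (1 - x))) = (x⁻¹ + (1 - x)⁻¹) / 2 := by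
      field_simp; ring
    rw [this]
    have i1 : x⁻¹ ≤ (((t : ℝ) + 1) / P)⁻¹ := inv_anti₀ (by positivity) hx0
    have i2 : (1 - x)⁻¹ ≤ (((r : ℝ) + 1) / P)⁻¹ := inv_anti₀ (by positivity) hx1
    rw [inv_div] at i1 i2
    calc (x⁻¹ + (1 - x)⁻¹) / 2 ≤ (P / (t + 1) + P / (r + 1)) / 2 := by gcongr
      _ = _ := by ring
  have hsum := Finset.sum_le_sum hmid
  rw [← Finset.mul_sum, Finset.sum_add_distrib] at hsum
  rw [Finset.sum_range_reflect (fun t : ℕ => ((t : ℝ) + 1)⁻¹) q] at hsum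
  have hH : ∑ t ∈ Finset.range q, ((t : ℝ) + 1)⁻¹ ≤ 1 + Real.log q := by
    have := harmonic_le_one_add_log q
    unfold harmonic at this
    push_cast at this
    exact this
  have hq : Real.log q ≤ Real.log P := by
    apply Real.log_le_log
    · exact_mod_cast (by omega : 0 < q)
    · linarith
  have h3 : 3 ≤ Real.log P := by
    have l2 := Real.log_two_gt_d9
    rw [Real.le_log_iff_exp_le hPpos]
    have h31 : (31 : ℝ) ≤ P := by rw [hP]; exact_mod_cast hp
    refine le_trans ?_ h31
    rw [show (3 : ℝ) = ((3 : ℕ) : ℝ) * 1 by norm_num, Real.exp_nat_mul]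
    calc Real.exp 1 ^ 3 ≤ (2.7182818286 : ℝ) ^ 3 := by
            gcongr; exact Real.exp_one_lt_d9.le
      _ ≤ 31 := by norm_num
  have hfin : P / 2 * (∑ t ∈ Finset.range q, ((t : ℝ) + 1)⁻¹ + ∑ t ∈ Finset.range q, ((t : ℝ) + 1)⁻¹)
      ≤ P * (1 + Real.log P) := by
    rw [show ∀ s : ℝ, P / 2 * (s + s) = P * s by intro s; ring]
    gcongr; linarith
  nlinarith

lemma S_bound (p : ℕ) (hp : 4 ≤ p) (a b : ℕ) (hab : a ≤ b) (hb : b < p) (u : ℝ) :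
    ∑ t ∈ Finset.range p, F1 a b (u + t / p) ≤ p * (2 * Real.log p) := by
  rcases le_or_gt p 30 with h | h
  · exact S_small p hp h a b hb u
  have hp0 : (0 : ℝ) < p := by exact_mod_cast (by omega : 0 < p)
  have hper : Function.Periodic (fun u : ℝ => ∑ t ∈ Finset.range p, F1 a b (u + t / p))
      (1 / (p : ℝ)) := by
    intro v
    have h1 := Finset.sum_range_succ (fun t : ℕ => F1 a b (v + t / p)) p
    have h2 := Finset.sum_range_succ' (fun t : ℕ => F1 a b (v + t / p)) p
    have h3 : F1 a b (v + (p : ℕ) / p) = F1 a b (v + (0 : ℕ) / p) := by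
      rw [div_self hp0.ne']
      simpa using F1_add_nat a b v 1
    rw [h1, h3] at h2
    have h4 := add_right_cancel h2
    beta_reduce
    rw [h4]
    apply Finset.sum_congr rfl; intro t _
    congr 1; push_cast; ring
  obtain ⟨y, hy, hxy⟩ := hper.exists_mem_Ico₀ (by positivity) u
  rw [hxy]
  exact S_large_aux p h a b hab hb y hy.1 hy.2

lemma sum_range_mul_aux (p : ℕ) (f : ℕ → ℝ) (m : ℕ) :
    ∑ x ∈ Finset.range (m * p), f x =
      ∑ y ∈ Finset.range m, ∑ t ∈ Finset.range p, f (y * p + t) := by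
  induction m with
  | zero => simp
  | succ m ih => rw [Nat.succ_mul, Finset.sum_range_add, ih, Finset.sum_range_succ]

lemma T_bound (p : ℕ) (hp : 1 ≤ p) (G : ℝ → ℝ) (hG0 : ∀ x, 0 ≤ G x)
    (hGp : ∀ x (m : ℕ), G (x + m) = G x) (S : ℝ)
    (hS : ∀ u, ∑ t ∈ Finset.range p, G (u + t / p) ≤ S) (k : ℕ) : ∀ θ : ℝ,
    ∑ x ∈ Finset.range (p ^ k), ∏ j ∈ Finset.range k, G (((p : ℝ) ^ (j + 1))⁻¹ * (x + θ)) ≤ S ^ k := by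
  have hp0 : (p : ℝ) ≠ 0 := by positivity
  have hS0 : 0 ≤ S := (Finset.sum_nonneg fun t _ => hG0 _).trans (hS 0)
  induction k with
  | zero => intro θ; simp
  | succ k ih =>
    intro θ
    rw [pow_succ p, sum_range_mul_aux, Finset.sum_comm]
    have h1 : ∀ t ∈ Finset.range p, ∑ y ∈ Finset.range (p ^ k),
        ∏ j ∈ Finset.range (k + 1), G (((p : ℝ) ^ (j + 1))⁻¹ * (((y * p + t : ℕ) : ℝ) + θ)) ≤
        G (θ / p + t / p) * S ^ k := by
      intro t _
      have h2 : ∀ y ∈ Finset.range (p ^ k),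
          ∏ j ∈ Finset.range (k + 1), G (((p : ℝ) ^ (j + 1))⁻¹ * (((y * p + t : ℕ) : ℝ) + θ)) =
          G (θ / p + t / p) * ∏ j ∈ Finset.range k, G (((p : ℝ) ^ (j + 1))⁻¹ * (y + (t + θ) / p)) := by
        intro y _
        rw [Finset.prod_range_succ', mul_comm]
        congr 1
        · rw [← hGp (θ / p + t / p) y]
          congr 1; push_cast; field_simp; ring
        · apply Finset.prod_congr rfl; intro j _
          congr 1; push_cast; rw [pow_succ _ (j+1)]; field_simp; ring
      rw [Finset.sum_congr rfl h2, ← Finset.mul_sum]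
      exact mul_le_mul_of_nonneg_left (ih _) (hG0 _)
    refine (Finset.sum_le_sum h1).trans ?_
    rw [← Finset.sum_mul, pow_succ', ]
    exact mul_le_mul_of_nonneg_right (hS _) (by positivity)

lemma T_bound2 (p : ℕ) (hp : 1 ≤ p) (G : ℝ → ℝ) (hG0 : ∀ x, 0 ≤ G x)
    (hGp : ∀ x (m : ℕ), G (x + m) = G x) (S : ℝ)
    (hS : ∀ u, ∑ t ∈ Finset.range p, G (u + t / p) ≤ S) (k : ℕ) (θ : ℝ) :
    ∑ x ∈ Finset.Ico (-((p ^ k : ℕ) : ℤ)) ((p ^ k : ℕ) : ℤ),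
      ∏ j ∈ Finset.range k, G (((p : ℝ) ^ (j + 1))⁻¹ * ((x : ℝ) + θ)) ≤ 2 * S ^ k := by
  set N := p ^ k with hN
  have himg : Finset.Ico (-(N : ℤ)) (N : ℤ) =
      (Finset.range (N + N)).image (fun m : ℕ => (m : ℤ) - N) := by
    ext z
    simp only [Finset.mem_Ico, Finset.mem_image, Finset.mem_range]
    constructor
    · intro h; exact ⟨(z + N).toNat, by omega, by omega⟩
    · rintro ⟨m, hm, rfl⟩; omega
  rw [himg, Finset.sum_image (by intro x _ y _ h; simpa using h), Finset.sum_range_add]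
  have t1 := T_bound p hp G hG0 hGp S hS k (θ - N)
  have t2 := T_bound p hp G hG0 hGp S hS k θ
  rw [two_mul]
  refine add_le_add (le_trans (le_of_eq ?_) t1) (le_trans (le_of_eq ?_) t2)
  · apply Finset.sum_congr rfl; intro x _
    apply Finset.prod_congr rfl; intro j _
    congr 1; push_cast; ring
  · apply Finset.sum_congr rfl; intro x _
    apply Finset.prod_congr rfl; intro j _
    congr 1; push_cast; ring

/-- normalised one-dimensional factor -/
def G1 (a b : ℕ) (x : ℝ) : ℝ := ((Finset.Icc a b).card : ℝ)⁻¹ * F1 a b x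

lemma gD_norm {n : ℕ} (a b : Fin n → ℕ) (ξ : EuclideanSpace ℝ (Fin n)) :
    ‖gD (Fintype.piFinset fun j => Finset.Icc (a j) (b j)) ξ‖ = ∏ i, G1 (a i) (b i) (ξ i) := by
  unfold gD G1 F1
  rw [Finset.prod_mul_distrib, ← norm_prod, Finset.prod_univ_sum, norm_mul, norm_inv,
    Complex.norm_natCast, Fintype.card_piFinset, Nat.cast_prod, Finset.prod_inv_distrib]
  congr 2
  apply Finset.sum_congr rfl; intro d _
  unfold eE
  rw [← Complex.exp_sum]
  congr 1
  rw [← Finset.sum_mul]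
  congr 1
  push_cast
  rw [Finset.mul_sum, Finset.sum_neg_distrib]

lemma gD_norm_le {n : ℕ} (D : Finset (Fin n → ℕ)) (ξ : EuclideanSpace ℝ (Fin n)) :
    ‖gD D ξ‖ ≤ 1 := by
  unfold gD
  rw [norm_mul, norm_inv, Complex.norm_natCast]
  have : ‖∑ d ∈ D, Complex.exp ((((-(2 * Real.pi * ∑ i, (d i : ℝ) * ξ i)) : ℝ) : ℂ) * Complex.I)‖
      ≤ D.card := by
    refine (norm_sum_le _ _).trans ?_
    simp only [Complex.norm_exp_ofReal_mul_I]
    simp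
  calc _ ≤ (D.card : ℝ)⁻¹ * D.card := by gcongr
    _ ≤ 1 := inv_mul_le_one

lemma gD_sub_one {n : ℕ} (D : Finset (Fin n → ℕ)) (hD : D.Nonempty)
    (ξ : EuclideanSpace ℝ (Fin n)) :
    ‖gD D ξ - 1‖ ≤ (D.card : ℝ)⁻¹ * ∑ d ∈ D, 2 * Real.pi * |∑ i, (d i : ℝ) * ξ i| := by
  have hc : (D.card : ℂ) ≠ 0 := by exact_mod_cast hD.card_ne_zero
  have h : gD D ξ - 1 = (D.card : ℂ)⁻¹ * ∑ d ∈ D, (eE (∑ i, (d i : ℝ) * ξ i) - 1) := by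
    unfold gD eE
    rw [Finset.sum_sub_distrib, mul_sub]
    simp [hc]
  rw [h, norm_mul, norm_inv, Complex.norm_natCast]
  gcongr
  refine (norm_sum_le _ _).trans (Finset.sum_le_sum fun d _ => eE_sub_one_le _)

lemma mult_gD {n : ℕ} (p : ℕ) (hp : 2 ≤ p) (D : Finset (Fin n → ℕ)) (hD : D.Nonempty)
    (ξ : EuclideanSpace ℝ (Fin n)) :
    Multipliable fun j : ℕ => gD D (((p : ℝ) ^ (j + 1))⁻¹ • ξ) := by
  have h : Summable fun j : ℕ => ‖gD D (((p : ℝ) ^ (j + 1))⁻¹ • ξ) - 1‖ := by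
    have hp1 : (1 : ℝ) < p := by exact_mod_cast hp
    have hg : Summable fun j : ℕ => ((p : ℝ)⁻¹) ^ j * ((p : ℝ)⁻¹ *
        ((D.card : ℝ)⁻¹ * ∑ d ∈ D, 2 * Real.pi * |∑ i, (d i : ℝ) * ξ i|)) :=
      (summable_geometric_of_lt_one (by positivity) (inv_lt_one_of_one_lt₀ hp1)).mul_right _
    refine Summable.of_nonneg_of_le (fun _ => norm_nonneg _) (fun j => ?_) hg
    refine (gD_sub_one D hD _).trans (le_of_eq ?_)
    have : ∀ d ∈ D, 2 * Real.pi * |∑ i, (d i : ℝ) * (((p : ℝ) ^ (j + 1))⁻¹ • ξ) i| =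
        ((p : ℝ) ^ (j + 1))⁻¹ * (2 * Real.pi * |∑ i, (d i : ℝ) * ξ i|) := by
      intro d _
      have : ∑ i, (d i : ℝ) * (((p : ℝ) ^ (j + 1))⁻¹ • ξ) i =
          ((p : ℝ) ^ (j + 1))⁻¹ * ∑ i, (d i : ℝ) * ξ i := by
        rw [Finset.mul_sum]; apply Finset.sum_congr rfl; intro i _
        simp; ring
      rw [this, abs_mul, abs_of_pos (by positivity)]; ring
    rw [Finset.sum_congr rfl this, ← Finset.mul_sum, pow_succ]
    simp only [inv_pow, mul_inv]; ring
  have := multipliable_one_add_of_summable h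
  simpa using this

lemma mft_bound {n : ℕ} (p : ℕ) (hp : 2 ≤ p) (D : Finset (Fin n → ℕ)) (hD : D.Nonempty)
    (ξ : EuclideanSpace ℝ (Fin n)) (k : ℕ) :
    ‖∏' j : ℕ, gD D (((p : ℝ) ^ (j + 1))⁻¹ • ξ)‖ ≤
      ∏ j ∈ Finset.range k, ‖gD D (((p : ℝ) ^ (j + 1))⁻¹ • ξ)‖ := by
  have h := (mult_gD p hp D hD ξ).hasProd.tendsto_prod_nat.norm
  refine le_of_tendsto h ?_
  filter_upwards [eventually_ge_atTop k] with N hN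
  rw [norm_prod]
  exact Finset.prod_le_prod_of_subset_of_le_one (Finset.range_mono hN)
    (fun _ _ => norm_nonneg _) (fun _ _ _ => gD_norm_le _ _)

lemma latSum_eq {n : ℕ} (μ : Measure (EuclideanSpace ℝ (Fin n))) (R : ℝ)
    (θ : EuclideanSpace ℝ (Fin n)) (N : ℕ) (hN : R < N) :
    latSum μ R θ = ∑ ξ ∈ Fintype.piFinset (fun _ : Fin n => Finset.Ico (-(N : ℤ)) (N : ℤ)),
      if ‖lat ξ‖ ≤ R then ‖mft μ (lat ξ + θ)‖ else 0 := by
  unfold latSum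
  apply tsum_eq_sum
  intro ξ hξ
  rw [if_neg]
  intro hle
  apply hξ
  rw [Fintype.mem_piFinset]
  intro i
  have h1 := PiLp.norm_apply_le (lat ξ) i
  have h2 : |(ξ i : ℝ)| < N := by
    have : (lat ξ) i = (ξ i : ℝ) := rfl
    rw [this, Real.norm_eq_abs] at h1
    linarith
  rw [abs_lt] at h2
  rw [Finset.mem_Ico]
  constructor
  · have : -(N : ℝ) ≤ ξ i := h2.1.le
    exact_mod_cast this
  · exact_mod_cast h2.2

lemma latSum_ge_one {n : ℕ} (μ : Measure (EuclideanSpace ℝ (Fin n))) [IsProbabilityMeasure μ]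
    (R : ℝ) (hR : 1 ≤ R) : 1 ≤ latSum μ R 0 := by
  obtain ⟨N, hN⟩ := exists_nat_gt R
  rw [latSum_eq μ R 0 N hN]
  have hN0 : 0 < N := by
    have : (0 : ℝ) < N := by linarith
    exact_mod_cast this
  have hl : lat (0 : Fin n → ℤ) = 0 := by
    ext i; simp [lat]
  have hm : (0 : Fin n → ℤ) ∈ Fintype.piFinset (fun _ : Fin n => Finset.Ico (-(N : ℤ)) (N : ℤ)) := by
    rw [Fintype.mem_piFinset]; intro i
    rw [Finset.mem_Ico]; simp; omega
  refine le_trans (le_of_eq ?_) (Finset.single_le_sum (f := fun ξ : Fin n → ℤ =>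
    if ‖lat ξ‖ ≤ R then ‖mft μ (lat ξ + 0)‖ else 0) (fun ξ _ => ?_) hm)
  · simp only [hl, norm_zero, add_zero]
    rw [if_pos (by linarith)]
    simp [mft]
  · beta_reduce; split_ifs
    · exact norm_nonneg _
    · exact le_rfl

lemma latSum_bound (n p : ℕ) (hp : 4 ≤ p)
    (a b : Fin n → ℕ) (hab : ∀ j, a j ≤ b j) (hbp : ∀ j, b j < p)
    (D : Finset (Fin n → ℕ))
    (hD : D = Fintype.piFinset fun j => Finset.Icc (a j) (b j))
    (lam : Measure (EuclideanSpace ℝ (Fin n)))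
    (hft : ∀ ξ : EuclideanSpace ℝ (Fin n),
      mft lam ξ = ∏' j : ℕ, gD D (((p : ℝ) ^ (j + 1))⁻¹ • ξ))
    (R : ℝ) (θ : EuclideanSpace ℝ (Fin n)) (k : ℕ) (hk : R < (p : ℝ) ^ k) :
    latSum lam R θ ≤ 2 ^ n * (((D.card : ℝ)⁻¹ * (p * (2 * Real.log p)) ^ n)) ^ k := by
  have hne : D.Nonempty := by
    rw [hD, Fintype.piFinset_nonempty]; intro j; exact Finset.nonempty_Icc.mpr (hab j)
  rw [latSum_eq lam R θ (p ^ k) (by push_cast; exact hk)]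
  have h1 : ∀ ξ ∈ Fintype.piFinset (fun _ : Fin n => Finset.Ico (-((p ^ k : ℕ) : ℤ)) ((p ^ k : ℕ) : ℤ)),
      (if ‖lat ξ‖ ≤ R then ‖mft lam (lat ξ + θ)‖ else 0) ≤
      ∏ i, ∏ j ∈ Finset.range k, G1 (a i) (b i) (((p : ℝ) ^ (j + 1))⁻¹ * ((ξ i : ℝ) + θ i)) := by
    intro ξ _
    have hb : ‖mft lam (lat ξ + θ)‖ ≤
      ∏ i, ∏ j ∈ Finset.range k, G1 (a i) (b i) (((p : ℝ) ^ (j + 1))⁻¹ * ((ξ i : ℝ) + θ i)) := by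
      rw [hft]
      refine (mft_bound p (by omega) D hne _ k).trans (le_of_eq ?_)
      rw [Finset.prod_comm]
      apply Finset.prod_congr rfl; intro j _
      rw [hD, gD_norm]
      rfl
    split_ifs
    · exact hb
    · exact (norm_nonneg _).trans hb
  refine (Finset.sum_le_sum h1).trans ?_
  rw [← Finset.prod_univ_sum (fun _ : Fin n => Finset.Ico (-((p ^ k : ℕ) : ℤ)) ((p ^ k : ℕ) : ℤ))
    (fun i (x : ℤ) => ∏ j ∈ Finset.range k, G1 (a i) (b i) (((p : ℝ) ^ (j + 1))⁻¹ * ((x : ℝ) + θ i)))]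
  have hG0 : ∀ i x, 0 ≤ G1 (a i) (b i) x := fun i x =>
    mul_nonneg (by positivity) (F1_nonneg _ _ _)
  have h2 : ∀ i ∈ (Finset.univ : Finset (Fin n)),
      ∑ x ∈ Finset.Ico (-((p ^ k : ℕ) : ℤ)) ((p ^ k : ℕ) : ℤ),
        ∏ j ∈ Finset.range k, G1 (a i) (b i) (((p : ℝ) ^ (j + 1))⁻¹ * ((x : ℝ) + θ i)) ≤
      2 * (((Finset.Icc (a i) (b i)).card : ℝ)⁻¹ * (p * (2 * Real.log p))) ^ k := by
    intro i _
    apply T_bound2 p (by omega) (G1 (a i) (b i)) (hG0 i)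
    · intro x m; unfold G1; rw [F1_add_nat]
    · intro u; unfold G1; rw [← Finset.mul_sum]
      exact mul_le_mul_of_nonneg_left (S_bound p hp _ _ (hab i) (hbp i) u) (by positivity)
  refine (Finset.prod_le_prod (fun i _ => Finset.sum_nonneg fun x _ =>
    Finset.prod_nonneg fun j _ => hG0 _ _) h2).trans (le_of_eq ?_)
  rw [Finset.prod_mul_distrib, Finset.prod_pow, Finset.prod_mul_distrib, hD,
    Fintype.card_piFinset, Nat.cast_prod, Finset.prod_inv_distrib]
  simp

/-- for `p ≥ 4` and a rectangular digit set
`D = ([a₁,b₁] × … × [a_n,b_n]) ∩ {0,…,p-1}ⁿ`, the missing digits measure `λ_{p,D}`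
(characterised by its Fourier transform) satisfies
`dim_{l¹} λ_{p,D} ≥ log(#D)/log p - n·log(2·log p)/log p`. -/
theorem statement10 (n p : ℕ) (hn : 1 ≤ n) (hp : 4 ≤ p)
    (a b : Fin n → ℕ) (hab : ∀ j, a j ≤ b j) (hbp : ∀ j, b j < p)
    (D : Finset (Fin n → ℕ))
    (hD : D = Fintype.piFinset fun j => Finset.Icc (a j) (b j))
    (lam : Measure (EuclideanSpace ℝ (Fin n))) [IsProbabilityMeasure lam]
    (hft : ∀ ξ : EuclideanSpace ℝ (Fin n),
      mft lam ξ = ∏' j : ℕ, gD D (((p : ℝ) ^ (j + 1))⁻¹ • ξ)) :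
    diml1 lam ≥
      Real.log D.card / Real.log p - n * Real.log (2 * Real.log p) / Real.log p := by
  have hne : D.Nonempty := by
    rw [hD, Fintype.piFinset_nonempty]; intro j; exact Finset.nonempty_Icc.mpr (hab j)
  have hp1 : (1 : ℝ) < p := by exact_mod_cast (by omega : 1 < p)
  have hp0 : (0 : ℝ) < p := by linarith
  have hlog : 0 < Real.log p := Real.log_pos hp1
  have hlog1 : 1 ≤ Real.log p := by
    rw [Real.le_log_iff_exp_le hp0]
    have : (4 : ℝ) ≤ p := by exact_mod_cast hp
    have := Real.exp_one_lt_d9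
    linarith
  have hc : (0 : ℝ) < D.card := by exact_mod_cast hne.card_pos
  have hcard : (D.card : ℝ) ≤ (p : ℝ) ^ n := by
    have : D.card ≤ p ^ n := by
      rw [hD, Fintype.card_piFinset]
      calc _ ≤ ∏ _i : Fin n, p := by
            apply Finset.prod_le_prod' ; intro i _
            rw [Nat.card_Icc]; have := hbp i; omega
        _ = p ^ n := by simp
    exact_mod_cast this
  set s := Real.log D.card / Real.log p - n * Real.log (2 * Real.log p) / Real.log p with hs
  have hsl : s * Real.log p = Real.log D.card - n * Real.log (2 * Real.log p) := by
    rw [hs]; field_simp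
  have hsn : s ≤ n := by
    have h1 : Real.log D.card ≤ n * Real.log p := by
      rw [← Real.log_pow]; exact Real.log_le_log hc hcard
    have h2 : 0 ≤ (n : ℝ) * Real.log (2 * Real.log p) :=
      mul_nonneg (by positivity) (Real.log_nonneg (by linarith))
    have h3 : s * Real.log p ≤ n * Real.log p := by rw [hsl]; linarith
    exact le_of_mul_le_mul_right h3 hlog
  have hbase : (D.card : ℝ)⁻¹ * (p * (2 * Real.log p)) ^ n = (p : ℝ) ^ ((n : ℝ) - s) := by
    rw [← Real.log_injOn_pos.eq_iff (show _ ∈ Set.Ioi (0:ℝ) by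
        simp only [Set.mem_Ioi]; positivity) (show _ ∈ Set.Ioi (0:ℝ) by
        simp only [Set.mem_Ioi]; positivity)]
    rw [Real.log_rpow hp0, sub_mul, hsl, Real.log_mul (by positivity) (by positivity),
      Real.log_inv, Real.log_pow, Real.log_mul (by positivity) (by positivity)]
    ring
  unfold diml1
  by_cases hs0 : s ≤ 0
  · refine ge_iff_le.mpr (hs0.trans (Real.sSup_nonneg ?_))
    rintro x ⟨hx, _⟩; exact hx.le
  push Not at hs0
  refine le_csSup ⟨n, ?_⟩ ⟨hs0, 2 ^ n * (p : ℝ) ^ ((n : ℝ) - s), by positivity, ?_⟩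
  · rintro x ⟨hx, C, hC, hall⟩
    by_contra! hlt
    have ht := (tendsto_rpow_neg_atTop (y := x - n) (by linarith)).const_mul C
    rw [mul_zero] at ht
    have hev := (ht.eventually_lt_const (show (0 : ℝ) < 1 by norm_num)).and (eventually_ge_atTop 1)
    obtain ⟨R, hR1, hR⟩ := hev.exists
    have h1 := hall R hR 0 (by intro i; simp)
    have h2 := latSum_ge_one lam R hR
    rw [neg_sub] at hR1
    linarith
  · intro R hR θ _
    obtain ⟨k, hk1, hk2⟩ := exists_nat_pow_near hR hp1
    refine (latSum_bound n p hp a b hab hbp D hD lam hft R θ (k + 1) hk2).trans ?_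
    rw [hbase, pow_succ', mul_assoc]
    gcongr
    rw [← Real.rpow_natCast, ← Real.rpow_mul hp0.le, mul_comm, Real.rpow_mul hp0.le,
      Real.rpow_natCast]
    exact Real.rpow_le_rpow (by positivity) hk1 (by linarith)
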